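/- Let Γ : ℝ → ℝ³ be a 1-periodic Lipschitz curve, injective on [0,1), with positive length, and let v₁, v₂ be affine lines in ℝ³ such that Rot(2π/a₁, v₁) and Rot(2π/a₂, v₂) each map the image Γ(ℝ) onto itself, where a₁, a₂ ≥ 2 are integers with a₁ ≠ a₂. If v₁ ∩ v₂ = {p} consists of a single point, then v₁ is perpendicular to v₂ and one of the two integers a₁, a₂ equals 2 while the other one is ≥ 3. -/

import Mathlib

open MeasureTheory Real Set
open scoped ENNReal NNReal RealInnerProductSpace

/-- Rotation of `ℝ³` by angle `β` about the line through the origin with (unit) direction `u`,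
given by Rodrigues' formula
`x ↦ cos β · x + sin β · (u × x) + (1 − cos β)⟨u, x⟩ u`. -/
noncomputable def rotAxisDir (β : ℝ) (u x : EuclideanSpace ℝ (Fin 3)) :
    EuclideanSpace ℝ (Fin 3) :=
  Real.cos β • x
    + Real.sin β • ((WithLp.equiv 2 (Fin 3 → ℝ)).symm
        (crossProduct (WithLp.equiv 2 (Fin 3 → ℝ) u) (WithLp.equiv 2 (Fin 3 → ℝ) x)))
    + ((1 - Real.cos β) * ⟪u, x⟫) • u

/-- Rotation `Rot(β, ℓ)` of `ℝ³` by angle `β` about the affine line `ℓ = p + ℝu`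
(`u` a unit direction): `x ↦ p + R(x − p)` with `R` the rotation by `β` fixing `u`. -/
noncomputable def rotLine (β : ℝ) (p u : EuclideanSpace ℝ (Fin 3))
    (x : EuclideanSpace ℝ (Fin 3)) : EuclideanSpace ℝ (Fin 3) :=
  p + rotAxisDir β u (x - p)

/-- The action of a `3×3` matrix on `ℝ³` (as a Euclidean space). -/
noncomputable def mulVecE (S : Matrix (Fin 3) (Fin 3) ℝ) (x : EuclideanSpace ℝ (Fin 3)) :
    EuclideanSpace ℝ (Fin 3) :=
  (WithLp.equiv 2 (Fin 3 → ℝ)).symm (S.mulVec (WithLp.equiv 2 (Fin 3 → ℝ) x))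

/-- The affine line `p + ℝu` in `ℝ³`. -/
def affLine (p u : EuclideanSpace ℝ (Fin 3)) : Set (EuclideanSpace ℝ (Fin 3)) :=
  {x | ∃ c : ℝ, x = p + c • u}

open scoped MeasureTheory

/-- A preconnected set has `1`-dimensional measure at least the distance of any two of its
points. -/
theorem edist_le_hausdorffMeasure_of_isPreconnected {E : Type*} [MetricSpace E]
    [MeasurableSpace E] [BorelSpace E] {A : Set E} (hA : IsPreconnected A) {x y : E}
    (hx : x ∈ A) (hy : y ∈ A) : edist x y ≤ μH[1] A := by
  have hf : LipschitzWith 1 (fun z => dist x z) := LipschitzWith.dist_right x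
  have hsub : Icc 0 (dist x y) ⊆ (fun z => dist x z) '' A := by
    have := hA.intermediate_value hx hy hf.continuous.continuousOn
    simpa using this
  calc edist x y = volume (Icc 0 (dist x y)) := by rw [Real.volume_Icc, sub_zero, edist_dist]
    _ = μH[1] (Icc 0 (dist x y)) := by rw [hausdorffMeasure_real]
    _ ≤ μH[1] ((fun z => dist x z) '' A) := measure_mono hsub
    _ ≤ μH[1] A := by
      simpa using hf.lipschitzOnWith.hausdorffMeasure_image_le (s := A) zero_le_one

/-- Elements of equal norm of a circle agree up to sign. -/
theorem AddCircle.eq_or_eq_neg_of_norm_eq {L : ℝ} {a b : AddCircle L} (h : ‖a‖ = ‖b‖) :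
    a = b ∨ a = -b := by
  induction a using QuotientAddGroup.induction_on with | H a => ?_
  induction b using QuotientAddGroup.induction_on with | H b => ?_
  rw [AddCircle.norm_eq, AddCircle.norm_eq] at h
  have key : ∀ (x : ℝ) (n : ℤ), ((x - n * L : ℝ) : AddCircle L) = x := by
    intro x n
    rw [AddCircle.coe_sub, sub_eq_self, AddCircle.coe_eq_zero_iff]
    exact ⟨n, by simp⟩
  rcases abs_eq_abs.1 h with h | h
  · left
    rw [← key a, h, key]
  · right
    rw [← key a, h, AddCircle.coe_neg, key]

/-- A norm-preserving self-map, read through a map `φ` to a circle, is a translation or a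
reflection. -/
theorem AddCircle.translation_or_reflection {α : Type*} {L : ℝ} {C : Set α}
    (φ : α → AddCircle L) (S : α → α)
    (hS : ∀ x ∈ C, ∀ y ∈ C, ‖φ (S x) - φ (S y)‖ = ‖φ x - φ y‖) :
    ∃ c, (∀ x ∈ C, φ (S x) = c + φ x) ∨ ∀ x ∈ C, φ (S x) = c - φ x := by
  rcases C.eq_empty_or_nonempty with rfl | ⟨z, hz⟩
  · exact ⟨0, by simp⟩
  have hpt : ∀ x ∈ C, φ (S x) = φ (S z) - φ z + φ x ∨ φ (S x) = φ (S z) + φ z - φ x := by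
    intro x hx
    rcases eq_or_eq_neg_of_norm_eq (hS x hx z hz) with h | h
    · left; rw [sub_eq_iff_eq_add] at h; rw [h]; abel
    · right; rw [sub_eq_iff_eq_add] at h; rw [h]; abel
  by_cases hC : ∀ x ∈ C, φ (S x) = φ (S z) - φ z + φ x
  · exact ⟨_, Or.inl hC⟩
  push Not at hC
  obtain ⟨y, hy, hyne⟩ := hC
  have hy' := (hpt y hy).resolve_left hyne
  refine ⟨φ (S z) + φ z, Or.inr fun x hx => ?_⟩
  rcases hpt x hx with h | h
  · have hxy := hS x hx y hy
    rw [h, hy'] at hxy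
    rcases eq_or_eq_neg_of_norm_eq hxy with e | e
    · refine absurd ?_ hyne
      rw [hy']
      have : φ y + φ y = φ z + φ z := by
        rw [← sub_eq_zero] at e ⊢
        rw [← e]; abel
      rw [← sub_eq_zero] at this ⊢
      rw [← neg_zero, ← this]; abel
    · rw [h]
      rw [← sub_eq_zero] at e ⊢
      rw [← e]; abel
  · exact h

section ClosedCurve

variable {E : Type*} {Γ : ℝ → E}

theorem eq_or_endpoints_of_periodic_injOn (hper : Function.Periodic Γ 1)
    (hinj : InjOn Γ (Ico 0 1)) {x y : ℝ} (hx : x ∈ Icc (0:ℝ) 1) (hy : y ∈ Icc (0:ℝ) 1)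
    (h : Γ x = Γ y) : x = y ∨ (x = 0 ∧ y = 1) ∨ (x = 1 ∧ y = 0) := by
  have h01 : Γ 1 = Γ 0 := by simpa using hper 0
  have z : (0:ℝ) ∈ Ico (0:ℝ) 1 := by simp
  rcases hx.2.lt_or_eq with hx1 | rfl <;> rcases hy.2.lt_or_eq with hy1 | rfl
  · exact Or.inl (hinj ⟨hx.1, hx1⟩ ⟨hy.1, hy1⟩ h)
  · exact Or.inr (Or.inl ⟨hinj ⟨hx.1, hx1⟩ z (h.trans h01), rfl⟩)
  · exact Or.inr (Or.inr ⟨rfl, (hinj z ⟨hy.1, hy1⟩ (h01.symm.trans h)).symm⟩)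
  · exact Or.inl rfl

theorem Function.Periodic.exists_mem_Ico_of_mem_range (hper : Function.Periodic Γ 1) {x : E}
    (hx : x ∈ range Γ) : ∃ t ∈ Ico (0:ℝ) 1, Γ t = x := by
  obtain ⟨s, rfl⟩ := hx
  obtain ⟨t, ht, h⟩ := hper.exists_mem_Ico₀ one_pos s
  exact ⟨t, ht, h.symm⟩

variable [MetricSpace E]

/-- Two points of a closed curve outside a connected part of the curve do not separate it. -/
theorem not_inter_complementary_arcs (hcont : Continuous Γ)
    (hper : Function.Periodic Γ 1) (hinj : InjOn Γ (Ico 0 1)) {A : Set E}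
    (hA : IsPreconnected A) (hAC : A ⊆ range Γ) {p q : ℝ} (hp : 0 ≤ p) (hpq : p ≤ q)
    (hq : q ≤ 1) (hpA : Γ p ∉ A) (hqA : Γ q ∉ A)
    (h₁ : (A ∩ Γ '' Icc p q).Nonempty)
    (h₂ : (A ∩ (Γ '' Icc q 1 ∪ Γ '' Icc 0 p)).Nonempty) : False := by
  have hcl : ∀ a b : ℝ, IsClosed (Γ '' Icc a b) := fun a b =>
    (isCompact_Icc.image hcont).isClosed
  have hcov : A ⊆ Γ '' Icc p q ∪ (Γ '' Icc q 1 ∪ Γ '' Icc 0 p) := by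
    intro x hx
    obtain ⟨t, ht, rfl⟩ := hper.exists_mem_Ico_of_mem_range (hAC hx)
    rcases le_total t p with h | h
    · exact Or.inr (Or.inr ⟨t, ⟨ht.1, h⟩, rfl⟩)
    rcases le_total t q with h' | h'
    · exact Or.inl ⟨t, ⟨h, h'⟩, rfl⟩
    · exact Or.inr (Or.inl ⟨t, ⟨h', ht.2.le⟩, rfl⟩)
  obtain ⟨x, hxA, ⟨s, hs, rfl⟩, hx⟩ := isPreconnected_closed_iff.1 hA _ _ (hcl p q)
    ((hcl q 1).union (hcl 0 p)) hcov h₁ h₂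
  have hs' : s ∈ Icc (0:ℝ) 1 := ⟨hp.trans hs.1, hs.2.trans hq⟩
  rcases hx with ⟨t, ht, hts⟩ | ⟨t, ht, hts⟩
  · rcases eq_or_endpoints_of_periodic_injOn hper hinj
      ⟨(hp.trans hpq).trans ht.1, ht.2⟩ hs' hts with h | ⟨h, h'⟩ | ⟨h, h'⟩
    · exact hqA (le_antisymm (h ▸ ht.1) hs.2 ▸ hxA)
    · exact hqA (le_antisymm hq (h' ▸ hs.2) ▸ h' ▸ hxA)
    · exact hpA (le_antisymm (h' ▸ hs.1) hp ▸ h' ▸ hxA)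
  · rcases eq_or_endpoints_of_periodic_injOn hper hinj
      ⟨ht.1, ht.2.trans (hpq.trans hq)⟩ hs' hts with h | ⟨h, h'⟩ | ⟨h, h'⟩
    · exact hpA (le_antisymm hs.1 (h ▸ ht.2) ▸ hxA)
    · exact hqA (le_antisymm hq (h' ▸ hs.2) ▸ h' ▸ hxA)
    · exact hpA (le_antisymm (h' ▸ hs.1) hp ▸ h' ▸ hxA)

/-- A connected part of a closed curve contains one of the two arcs between any two of its
points. -/
theorem arc_subset_of_isPreconnected (hcont : Continuous Γ)
    (hper : Function.Periodic Γ 1) (hinj : InjOn Γ (Ico 0 1)) {A : Set E}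
    (hA : IsPreconnected A) (hAC : A ⊆ range Γ) {s t : ℝ} (hs : 0 ≤ s)
    (ht : t ≤ 1) (hsA : Γ s ∈ A) (htA : Γ t ∈ A) :
    Γ '' Icc s t ⊆ A ∨ Γ '' Icc t 1 ∪ Γ '' Icc 0 s ⊆ A := by
  by_contra! hcon
  obtain ⟨h₁, h₂⟩ := hcon
  obtain ⟨_, ⟨p, hp, rfl⟩, hpA⟩ := not_subset.1 h₁
  obtain ⟨_, ⟨q, hq, rfl⟩ | ⟨q, hq, rfl⟩, hqA⟩ := not_subset.1 h₂
  · exact not_inter_complementary_arcs hcont hper hinj hA hAC (hs.trans hp.1)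
      (hp.2.trans hq.1) hq.2 hpA hqA ⟨_, htA, t, ⟨hp.2, hq.1⟩, rfl⟩
      ⟨_, hsA, Or.inr ⟨s, ⟨hs, hp.1⟩, rfl⟩⟩
  · exact not_inter_complementary_arcs hcont hper hinj hA hAC hq.1
      (hq.2.trans hp.1) (hp.2.trans ht) hqA hpA ⟨_, hsA, s, ⟨hq.2, hp.1⟩, rfl⟩
      ⟨_, htA, Or.inl ⟨t, ⟨hp.2, ht⟩, rfl⟩⟩

variable [MeasurableSpace E] [BorelSpace E]

theorem hausdorffMeasure_image_Icc_add (hcont : Continuous Γ) (hper : Function.Periodic Γ 1)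
    (hinj : InjOn Γ (Ico 0 1)) {r s t : ℝ} (hr : 0 ≤ r) (hrs : r ≤ s) (hst : s ≤ t)
    (ht : t ≤ 1) :
    μH[1] (Γ '' Icc r t) = μH[1] (Γ '' Icc r s) + μH[1] (Γ '' Icc s t) := by
  have : NullSingletonClass (μH[1] : Measure E) :=
    Measure.nullSingletonClass_hausdorff E one_pos
  rw [← Icc_union_Icc_eq_Icc hrs hst, image_union]
  refine measure_union₀ (isCompact_Icc.image hcont).isClosed.nullMeasurableSet ?_
  refine measure_mono_null (t := {Γ s, Γ 0}) ?_ ((toFinite _).measure_zero _)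
  rintro _ ⟨⟨a, ha, rfl⟩, b, hb, hab⟩
  rcases eq_or_endpoints_of_periodic_injOn hper hinj ⟨(hr.trans hrs).trans hb.1, hb.2.trans ht⟩
    ⟨hr.trans ha.1, ha.2.trans (hst.trans ht)⟩ hab with h | ⟨h, h'⟩ | ⟨h, h'⟩
  · left; rw [le_antisymm ha.2 (h ▸ hb.1)]
  · right; rw [← hab, h]; rfl
  · right; rw [h']; rfl

theorem hausdorffMeasure_image_Icc_ne_top {K : NNReal} (hlip : LipschitzWith K Γ) (s t : ℝ) :
    μH[1] (Γ '' Icc s t) ≠ ∞ := by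
  refine ne_top_of_le_ne_top ?_ (hlip.lipschitzOnWith.hausdorffMeasure_image_le zero_le_one)
  rw [hausdorffMeasure_real, Real.volume_Icc]
  exact ENNReal.mul_ne_top (by simp) ENNReal.ofReal_ne_top

theorem hausdorffMeasure_complementary_arc (hcont : Continuous Γ)
    (hper : Function.Periodic Γ 1) (hinj : InjOn Γ (Ico 0 1)) {s t : ℝ} (hs : 0 ≤ s)
    (hst : s ≤ t) (ht : t ≤ 1) :
    μH[1] (Γ '' Icc t 1 ∪ Γ '' Icc 0 s) = μH[1] (Γ '' Icc t 1) + μH[1] (Γ '' Icc 0 s) := by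
  have : NullSingletonClass (μH[1] : Measure E) :=
    Measure.nullSingletonClass_hausdorff E one_pos
  refine measure_union₀ (isCompact_Icc.image hcont).isClosed.nullMeasurableSet ?_
  refine measure_mono_null (t := {Γ s, Γ 0, Γ 1}) ?_ ((toFinite _).measure_zero _)
  rintro _ ⟨⟨a, ha, rfl⟩, b, hb, hab⟩
  rcases eq_or_endpoints_of_periodic_injOn hper hinj ⟨hb.1, hb.2.trans (hst.trans ht)⟩
    ⟨(hs.trans hst).trans ha.1, ha.2⟩ hab with h | ⟨h, h'⟩ | ⟨h, h'⟩
  · left; rw [le_antisymm (h ▸ hb.2) (hst.trans ha.1)]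
  · right; right; rw [h']; rfl
  · right; left; rw [h']

theorem AddCircle.norm_coe_eq_min {L x : ℝ} (hx : 0 ≤ x) (hxL : x ≤ L) :
    ‖(x : AddCircle L)‖ = min x (L - x) := by
  rcases hx.eq_or_lt with rfl | hx0
  · simp [hxL]
  have hL : 0 < L := hx0.trans_le hxL
  rcases le_total x (L / 2) with h | h
  · rw [min_eq_left (by linarith), (AddCircle.norm_coe_eq_abs_iff L hL.ne').2, abs_of_nonneg hx]
    rw [abs_of_nonneg hx, abs_of_pos hL]; exact h
  · have h1 : (x : AddCircle L) = ((x - L : ℝ) : AddCircle L) := by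
      rw [AddCircle.coe_sub, AddCircle.coe_period, sub_zero]
    rw [min_eq_right (by linarith), h1, (AddCircle.norm_coe_eq_abs_iff L hL.ne').2,
      abs_of_nonpos (by linarith), neg_sub]
    rw [abs_of_nonpos (by linarith), abs_of_pos hL]; linarith

/-- Arc-length coordinate on a closed embedded rectifiable curve, as a map to a circle: the
distance in the circle of the coordinates of two points is the least `1`-dimensional measure of a
connected part of the curve containing both. -/
theorem exists_arcLength_coordinate {K : NNReal} (hlip : LipschitzWith K Γ)
    (hper : Function.Periodic Γ 1) (hinj : InjOn Γ (Ico 0 1)) :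
    ∃ (L : ℝ) (φ : E → AddCircle L), ∀ x ∈ range Γ, ∀ y ∈ range Γ,
      (∃ A ⊆ range Γ, IsPreconnected A ∧ x ∈ A ∧ y ∈ A ∧
        μH[1] A = ENNReal.ofReal ‖φ x - φ y‖) ∧
      ∀ A ⊆ range Γ, IsPreconnected A → x ∈ A → y ∈ A →
        ENNReal.ofReal ‖φ x - φ y‖ ≤ μH[1] A := by
  have hcont := hlip.continuous
  set f : ℝ → ℝ := fun t => (μH[1] (Γ '' Icc 0 t)).toReal with hf
  choose! τ hτ hΓτ using fun x (hx : x ∈ range Γ) => hper.exists_mem_Ico_of_mem_range hx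
  set φ : E → AddCircle (f 1) := fun x => (f (τ x) : AddCircle (f 1)) with hφ
  refine ⟨f 1, φ, ?_⟩
  have hfin := hausdorffMeasure_image_Icc_ne_top hlip
  have h01 : Γ 1 = Γ 0 := by simpa using hper 0
  have hsub : ∀ a b, Γ '' Icc a b ⊆ range Γ := fun a b => image_subset_range _ _
  have hpre : ∀ a b, IsPreconnected (Γ '' Icc a b) := fun a b =>
    isPreconnected_Icc.image _ hcont.continuousOn
  have key : ∀ x ∈ range Γ, ∀ y ∈ range Γ, τ x ≤ τ y →
      (∃ A ⊆ range Γ, IsPreconnected A ∧ x ∈ A ∧ y ∈ A ∧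
        μH[1] A = ENNReal.ofReal ‖φ y - φ x‖) ∧
      ∀ A ⊆ range Γ, IsPreconnected A → x ∈ A → y ∈ A →
        ENNReal.ofReal ‖φ y - φ x‖ ≤ μH[1] A := by
    intro x hx y hy hxy
    have hs0 := (hτ x hx).1
    have ht1 := (hτ y hy).2.le
    have hxs := hΓτ x hx
    have hyt := hΓτ y hy
    set s := τ x with hs
    set t := τ y with ht
    have hadd := hausdorffMeasure_image_Icc_add hcont hper hinj (le_refl 0) hs0 hxy ht1
    have hadd1 := hausdorffMeasure_image_Icc_add hcont hper hinj (le_refl 0) (hs0.trans hxy)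
      ht1 le_rfl
    have hcomp := hausdorffMeasure_complementary_arc hcont hper hinj hs0 hxy ht1
    have e1 : f t = f s + (μH[1] (Γ '' Icc s t)).toReal := by
      simp only [hf]
      rw [hadd, ENNReal.toReal_add (hfin _ _) (hfin _ _)]
    have e2 : f 1 = f t + (μH[1] (Γ '' Icc t 1)).toReal := by
      simp only [hf]
      rw [hadd1, ENNReal.toReal_add (hfin _ _) (hfin _ _)]
    have m1 : μH[1] (Γ '' Icc s t) = ENNReal.ofReal (f t - f s) := by
      rw [e1, add_sub_cancel_left, ENNReal.ofReal_toReal (hfin _ _)]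
    have m2 : μH[1] (Γ '' Icc t 1 ∪ Γ '' Icc 0 s) = ENNReal.ofReal (f 1 - (f t - f s)) := by
      have : f 1 - (f t - f s) = (μH[1] (Γ '' Icc t 1)).toReal + f s := by rw [e2]; ring
      rw [hcomp, this, ENNReal.ofReal_add ENNReal.toReal_nonneg ENNReal.toReal_nonneg,
        ENNReal.ofReal_toReal (hfin _ _), ENNReal.ofReal_toReal (hfin _ _)]
    have n0 : ∀ r, 0 ≤ f r := fun r => ENNReal.toReal_nonneg
    have n1 : 0 ≤ f t - f s := by rw [e1]; simp
    have n2 : f t - f s ≤ f 1 := by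
      have := n0 s
      have : 0 ≤ (μH[1] (Γ '' Icc t 1)).toReal := ENNReal.toReal_nonneg
      linarith
    have hnorm : ‖φ y - φ x‖ = min (f t - f s) (f 1 - (f t - f s)) := by
      rw [← AddCircle.norm_coe_eq_min n1 n2, AddCircle.coe_sub]
    rw [hnorm]
    constructor
    · rcases le_total (f t - f s) (f 1 - (f t - f s)) with h | h
      · rw [min_eq_left h, ← m1]
        exact ⟨_, hsub _ _, hpre _ _, ⟨s, ⟨le_rfl, hxy⟩, hxs⟩, ⟨t, ⟨hxy, le_rfl⟩, hyt⟩, rfl⟩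
      · rw [min_eq_right h, ← m2]
        exact ⟨_, union_subset (hsub _ _) (hsub _ _),
          (hpre _ _).union (Γ 0) ⟨1, ⟨ht1, le_rfl⟩, h01⟩ ⟨0, ⟨le_rfl, hs0⟩, rfl⟩ (hpre _ _),
          Or.inr ⟨s, ⟨hs0, le_rfl⟩, hxs⟩, Or.inl ⟨t, ⟨le_rfl, ht1⟩, hyt⟩, rfl⟩
    · intro A hAC hA hxA hyA
      rcases arc_subset_of_isPreconnected hcont hper hinj hA hAC hs0 ht1
        (hxs ▸ hxA) (hyt ▸ hyA) with h | h
      · refine le_trans ?_ (measure_mono h)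
        rw [m1]; exact ENNReal.ofReal_le_ofReal (min_le_left _ _)
      · refine le_trans ?_ (measure_mono h)
        rw [m2]; exact ENNReal.ofReal_le_ofReal (min_le_right _ _)
  intro x hx y hy
  rcases le_total (τ x) (τ y) with h | h
  · rw [norm_sub_rev]
    exact key x hx y hy h
  · obtain ⟨⟨A, hAC, hA, hyA, hxA, hm⟩, h'⟩ := key y hy x hx h
    exact ⟨⟨A, hAC, hA, hxA, hyA, hm⟩, fun A hAC hA hxA hyA => h' A hAC hA hyA hxA⟩

/-- Isometric symmetries of a closed embedded rectifiable curve act on it as a subgroup of the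
orthogonal group of the plane does: conjugating one that is not an involution by another one gives
the former or its inverse. -/
theorem commute_or_inverts_of_isometryEquiv {K : NNReal} (hlip : LipschitzWith K Γ)
    (hper : Function.Periodic Γ 1) (hinj : InjOn Γ (Ico 0 1)) (R S : E ≃ᵢ E)
    (hR : R '' range Γ = range Γ) (hS : S '' range Γ = range Γ)
    (hR2 : ∃ x ∈ range Γ, R (R x) ≠ x) :
    (∀ x ∈ range Γ, S (R x) = R (S x)) ∨ ∀ x ∈ range Γ, R (S (R x)) = S x := by
  obtain ⟨L, φ, hφ⟩ := exists_arcLength_coordinate hlip hper hinj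
  have hφinj : ∀ x ∈ range Γ, ∀ y ∈ range Γ, φ x = φ y → x = y := by
    intro x hx y hy h
    obtain ⟨A, -, hA, hxA, hyA, hm⟩ := (hφ x hx y hy).1
    have := edist_le_hausdorffMeasure_of_isPreconnected hA hxA hyA
    rw [hm, h, sub_self, norm_zero, ENNReal.ofReal_zero] at this
    exact edist_le_zero.1 this
  have hle : ∀ T : E ≃ᵢ E, T '' range Γ = range Γ → ∀ x ∈ range Γ, ∀ y ∈ range Γ,
      ‖φ (T x) - φ (T y)‖ ≤ ‖φ x - φ y‖ := by
    intro T hT x hx y hy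
    obtain ⟨A, hAC, hA, hxA, hyA, hm⟩ := (hφ x hx y hy).1
    have hTm : ∀ z ∈ range Γ, T z ∈ range Γ := fun z hz => hT ▸ mem_image_of_mem T hz
    have := (hφ (T x) (hTm x hx) (T y) (hTm y hy)).2 (T '' A) (hT ▸ image_mono hAC)
      (hA.image _ T.continuous.continuousOn) (mem_image_of_mem _ hxA) (mem_image_of_mem _ hyA)
    rw [T.isometry.hausdorffMeasure_image (Or.inl zero_le_one), hm] at this
    exact (ENNReal.ofReal_le_ofReal_iff (norm_nonneg _)).1 this
  have hiso : ∀ T : E ≃ᵢ E, T '' range Γ = range Γ → ∀ x ∈ range Γ, ∀ y ∈ range Γ,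
      ‖φ (T x) - φ (T y)‖ = ‖φ x - φ y‖ := by
    intro T hT x hx y hy
    have hTm : ∀ z ∈ range Γ, T z ∈ range Γ := fun z hz => hT ▸ mem_image_of_mem T hz
    refine le_antisymm (hle T hT x hx y hy) ?_
    have hT' : T.symm '' range Γ = range Γ := by
      conv_lhs => rw [← hT]
      rw [image_image]; simp
    simpa using hle T.symm hT' (T x) (hTm x hx) (T y) (hTm y hy)
  have hRm : ∀ z ∈ range Γ, R z ∈ range Γ := fun z hz => hR ▸ mem_image_of_mem R hz
  have hSm : ∀ z ∈ range Γ, S z ∈ range Γ := fun z hz => hS ▸ mem_image_of_mem S hz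
  obtain ⟨r, hr | hr⟩ := AddCircle.translation_or_reflection φ R (hiso R hR)
  · obtain ⟨c, hc | hc⟩ := AddCircle.translation_or_reflection φ S (hiso S hS)
    · left
      intro x hx
      refine hφinj _ (hSm _ (hRm _ hx)) _ (hRm _ (hSm _ hx)) ?_
      rw [hc _ (hRm _ hx), hr _ hx, hr _ (hSm _ hx), hc _ hx]; abel
    · right
      intro x hx
      refine hφinj _ (hRm _ (hSm _ (hRm _ hx))) _ (hSm _ hx) ?_
      rw [hr _ (hSm _ (hRm _ hx)), hc _ (hRm _ hx), hr _ hx, hc _ hx]; abel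
  · obtain ⟨x, hx, hne⟩ := hR2
    refine absurd (hφinj _ (hRm _ (hRm _ hx)) _ hx ?_) hne
    rw [hr _ (hRm _ hx), hr _ hx]; abel

end ClosedCurve

/-- A closed embedded curve admits no continuous injection to the line. -/
theorem not_injOn_real_of_closedCurve {E : Type*} [MetricSpace E] {Γ : ℝ → E}
    (hcont : Continuous Γ) (hper : Function.Periodic Γ 1) (hinj : InjOn Γ (Ico 0 1))
    {g : E → ℝ} (hg : Continuous g) : ¬ InjOn g (range Γ) := by
  intro hgi
  have h01 : Γ 1 = Γ 0 := by simpa using hper 0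
  have hc : Continuous (g ∘ Γ) := hg.comp hcont
  set m : ℝ := (g (Γ 0) + g (Γ (1/2))) / 2 with hm
  have hne : g (Γ 0) ≠ g (Γ (1/2)) := by
    intro h
    have := hinj (by norm_num) (by norm_num) (hgi (mem_range_self _) (mem_range_self _) h)
    norm_num at this
  have hmem : m ∈ uIcc (g (Γ 0)) (g (Γ (1/2))) := by
    rw [mem_uIcc]
    rcases le_total (g (Γ 0)) (g (Γ (1/2))) with h | h
    · left; constructor <;> linarith
    · right; constructor <;> linarith
  have hmem' : m ∈ uIcc (g (Γ (1/2))) (g (Γ 1)) := by rw [uIcc_comm, h01]; exact hmem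
  obtain ⟨a, ha, ham⟩ := intermediate_value_uIcc hc.continuousOn hmem
  obtain ⟨b, hb, hbm⟩ := intermediate_value_uIcc hc.continuousOn hmem'
  rw [uIcc_of_le (by norm_num)] at ha hb
  have hab : Γ a = Γ b := hgi (mem_range_self _) (mem_range_self _) (ham.trans hbm.symm)
  have hnm : m ≠ g (Γ (1/2)) := fun h => hne (by linarith)
  rcases eq_or_endpoints_of_periodic_injOn hper hinj ⟨ha.1, by linarith [ha.2]⟩
    ⟨by linarith [hb.1], hb.2⟩ hab with h | ⟨h, -⟩ | ⟨h, -⟩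
  · have : a = 1/2 := le_antisymm ha.2 (h ▸ hb.1)
    exact hnm (by rw [← ham, this]; rfl)
  · have : m = g (Γ 0) := by rw [← ham, h]; rfl
    exact hne (by linarith)
  · linarith [ha.2]

/-- The cross product on Euclidean `ℝ³`. -/
noncomputable def crossE (u x : EuclideanSpace ℝ (Fin 3)) : EuclideanSpace ℝ (Fin 3) :=
  (WithLp.equiv 2 (Fin 3 → ℝ)).symm
    (crossProduct (WithLp.equiv 2 (Fin 3 → ℝ) u) (WithLp.equiv 2 (Fin 3 → ℝ) x))

section CrossProduct

variable (u v w x y : EuclideanSpace ℝ (Fin 3)) (c : ℝ)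

theorem crossE_self : crossE u u = 0 := by
  ext i; fin_cases i <;> simp [crossE]

theorem crossE_add : crossE u (x + y) = crossE u x + crossE u y := by
  simp [crossE]

theorem crossE_sub : crossE u (x - y) = crossE u x - crossE u y := by
  simp [crossE]

theorem crossE_smul : crossE u (c • x) = c • crossE u x := by
  simp [crossE]

theorem crossE_zero : crossE u 0 = 0 := by
  simp [crossE]

theorem crossE_neg_comm : crossE x u = -crossE u x := by
  ext i; fin_cases i <;> simp [crossE, cross_apply] <;> ring

theorem crossE_crossE : crossE u (crossE v w) = ⟪u, w⟫ • v - ⟪u, v⟫ • w := by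
  ext i
  fin_cases i <;> simp [crossE, cross_apply, PiLp.inner_apply, Fin.sum_univ_three] <;> ring

theorem inner_self_crossE : ⟪u, crossE u x⟫ = (0 : ℝ) := by
  simp [crossE, cross_apply, PiLp.inner_apply, Fin.sum_univ_three]; ring

theorem inner_crossE_right : ⟪x, crossE u y⟫ = -⟪crossE u x, y⟫ := by
  simp [crossE, cross_apply, PiLp.inner_apply, Fin.sum_univ_three]; ring

variable {u v w x y}

theorem eq_inner_smul_of_crossE_eq_zero (hu : ‖u‖ = 1) (h : crossE u x = 0) :
    x = ⟪u, x⟫ • u := by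
  have := crossE_crossE u u x
  rw [h, crossE_zero, real_inner_self_eq_norm_sq, hu] at this
  simpa using (sub_eq_zero.1 this.symm).symm

/-- A vector orthogonal to both `b` and `u × b`, where `b` is a nonzero vector orthogonal to the
unit vector `u`, is parallel to `u`. -/
theorem crossE_eq_zero_of_inner_eq_zero {b : EuclideanSpace ℝ (Fin 3)} (hb : b ≠ 0)
    (hub : ⟪u, b⟫ = (0 : ℝ)) (h : ⟪v, b⟫ = (0 : ℝ)) (h' : ⟪v, crossE u b⟫ = (0 : ℝ)) :
    crossE u v = 0 := by
  have h1 : crossE b (crossE u b) = (‖b‖ ^ 2) • u := by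
    rw [crossE_crossE, real_inner_self_eq_norm_sq, real_inner_comm, hub]; simp
  have h2 := crossE_crossE v b (crossE u b)
  rw [h1, h, h', crossE_smul, crossE_neg_comm u v] at h2
  simpa [hb] using h2

end CrossProduct

section Rotation

variable (β : ℝ) (u x y : EuclideanSpace ℝ (Fin 3))

theorem rotAxisDir_eq :
    rotAxisDir β u x =
      Real.cos β • x + Real.sin β • crossE u x + ((1 - Real.cos β) * ⟪u, x⟫) • u := rfl

theorem rotAxisDir_sub : rotAxisDir β u (x - y) = rotAxisDir β u x - rotAxisDir β u y := by
  simp only [rotAxisDir_eq, crossE_sub, inner_sub_right]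
  module

theorem rotAxisDir_smul (c : ℝ) : rotAxisDir β u (c • x) = c • rotAxisDir β u x := by
  simp only [rotAxisDir_eq, crossE_smul, real_inner_smul_right]
  module

variable {u}

theorem rotAxisDir_self (hu : ‖u‖ = 1) : rotAxisDir β u u = u := by
  rw [rotAxisDir_eq, crossE_self, real_inner_self_eq_norm_sq, hu]
  module

theorem inner_rotAxisDir (hu : ‖u‖ = 1) : ⟪u, rotAxisDir β u x⟫ = ⟪u, x⟫ := by
  simp only [rotAxisDir_eq, inner_add_right, real_inner_smul_right, inner_self_crossE,
    real_inner_self_eq_norm_sq, hu]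
  ring

theorem rotAxisDir_neg_rotAxisDir (hu : ‖u‖ = 1) :
    rotAxisDir (-β) u (rotAxisDir β u x) = x := by
  rw [rotAxisDir_eq (-β), inner_rotAxisDir _ _ hu]
  simp only [rotAxisDir_eq, crossE_add, crossE_smul, crossE_self, crossE_crossE, Real.cos_neg,
    Real.sin_neg, real_inner_self_eq_norm_sq, hu]
  match_scalars
  · linear_combination Real.sin_sq_add_cos_sq β
  · ring
  · linear_combination (-⟪u, x⟫) * Real.sin_sq_add_cos_sq β

theorem inner_rotAxisDir_rotAxisDir (hu : ‖u‖ = 1) :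
    ⟪rotAxisDir β u x, rotAxisDir β u y⟫ = ⟪x, y⟫ := by
  have h : ∀ z, ⟪rotAxisDir β u x, z⟫ = ⟪x, rotAxisDir (-β) u z⟫ := by
    intro z
    simp only [rotAxisDir_eq, inner_add_left, inner_add_right, real_inner_smul_left,
      real_inner_smul_right, Real.cos_neg, Real.sin_neg, inner_crossE_right u x,
      real_inner_comm u]
    ring
  rw [h, rotAxisDir_neg_rotAxisDir _ _ hu]

/-- Rotation about an affine line, as an isometry of `ℝ³`. -/
noncomputable def rotLineEquiv (p : EuclideanSpace ℝ (Fin 3)) (hu : ‖u‖ = 1) :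
    EuclideanSpace ℝ (Fin 3) ≃ᵢ EuclideanSpace ℝ (Fin 3) where
  toFun := rotLine β p u
  invFun := rotLine (-β) p u
  left_inv x := by simp [rotLine, rotAxisDir_neg_rotAxisDir _ _ hu]
  right_inv x := by
    have := rotAxisDir_neg_rotAxisDir (-β) (x - p) hu
    rw [neg_neg] at this
    simp [rotLine, this]
  isometry_toFun := by
    refine Isometry.of_dist_eq fun x y => ?_
    have h : ‖rotAxisDir β u (x - y)‖ = ‖x - y‖ := by
      rw [norm_eq_sqrt_real_inner, inner_rotAxisDir_rotAxisDir _ _ _ hu,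
        ← norm_eq_sqrt_real_inner]
    rw [dist_eq_norm, dist_eq_norm, ← h, ← sub_sub_sub_cancel_right x y p, rotAxisDir_sub]
    simp [rotLine]

theorem rotLine_eq_of_mem_affLine {p q : EuclideanSpace ℝ (Fin 3)} (hu : ‖u‖ = 1)
    (hq : q ∈ affLine p u) : rotLine β p u = rotLine β q u := by
  obtain ⟨c, rfl⟩ := hq
  funext x
  have : x - (p + c • u) = (x - p) - c • u := by abel
  rw [rotLine, rotLine, this, rotAxisDir_sub β u (x - p), rotAxisDir_smul, rotAxisDir_self _ hu]
  abel

variable {β x}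

theorem crossE_eq_zero_of_rotAxisDir_involutive (hu : ‖u‖ = 1) (hβ : Real.sin β ≠ 0)
    (h : rotAxisDir β u (rotAxisDir β u x) = x) : crossE u x = 0 := by
  have h' := rotAxisDir_neg_rotAxisDir β (rotAxisDir β u x) hu
  rw [h, rotAxisDir_eq, rotAxisDir_eq, Real.cos_neg, Real.sin_neg] at h'
  have h2 : (2 * Real.sin β) • crossE u x = 0 := by
    rw [← sub_eq_zero] at h'
    rw [← neg_eq_zero, ← h']
    module
  simpa [hβ] using h2

/-- If the inner product with `v` is constant along a rotation orbit off the axis `u`,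
then `v` is parallel to `u`. -/
theorem crossE_eq_zero_of_inner_orbit {v : EuclideanSpace ℝ (Fin 3)} (hu : ‖u‖ = 1)
    (hβ : Real.sin β ≠ 0) (hx : crossE u x ≠ 0)
    (h₁ : ⟪v, rotAxisDir β u x⟫ = ⟪v, x⟫)
    (h₂ : ⟪v, rotAxisDir β u (rotAxisDir β u x)⟫ = ⟪v, rotAxisDir β u x⟫) :
    crossE u v = 0 := by
  set b := rotAxisDir β u x - x with hb
  have hb0 : b ≠ 0 := by
    intro h0
    have h0' : rotAxisDir β u x = x := sub_eq_zero.1 h0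
    exact hx (crossE_eq_zero_of_rotAxisDir_involutive hu hβ (by rw [h0', h0']))
  have hub : ⟪u, b⟫ = (0 : ℝ) := by
    rw [hb, inner_sub_right, inner_rotAxisDir _ _ hu, sub_self]
  have hvb : ⟪v, b⟫ = (0 : ℝ) := by rw [hb, inner_sub_right, h₁, sub_self]
  have hvb' : ⟪v, rotAxisDir β u b⟫ = (0 : ℝ) := by
    rw [hb, rotAxisDir_sub, inner_sub_right, h₂, sub_self]
  refine crossE_eq_zero_of_inner_eq_zero hb0 hub hvb ?_
  rw [rotAxisDir_eq, hub, inner_add_right, inner_add_right, real_inner_smul_right, hvb,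
    real_inner_smul_right] at hvb'
  simpa [hβ] using hvb'

theorem sin_two_pi_div_ne_zero {a : ℕ} (ha : 3 ≤ a) : Real.sin (2 * Real.pi / a) ≠ 0 := by
  have ha' : (3 : ℝ) ≤ a := by exact_mod_cast ha
  refine (Real.sin_pos_of_pos_of_lt_pi (by positivity) ?_).ne'
  rw [div_lt_iff₀ (by linarith)]
  nlinarith [Real.pi_pos]

/-- A rotation by `2π / a` mapping the direction `u` to `± u`, where `u` is not parallel to its
axis, is a half-turn about an axis orthogonal to `u`. -/
theorem half_turn_of_preserves_direction {w : EuclideanSpace ℝ (Fin 3)} {a : ℕ} (ha : 2 ≤ a)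
    (huw : crossE u w ≠ 0)
    (h : crossE u (rotAxisDir (-(2 * Real.pi / a)) w u) = 0) (hu : ‖u‖ = 1) :
    a = 2 ∧ ⟪u, w⟫ = (0 : ℝ) := by
  set α := 2 * Real.pi / a with hα
  have hv := eq_inner_smul_of_crossE_eq_zero hu h
  have ha2 : a = 2 := by
    by_contra hne
    have hs : Real.sin α ≠ 0 := sin_two_pi_div_ne_zero (by omega)
    have h1 := congrArg (fun z => ⟪crossE u w, z⟫) hv
    have e1 : ⟪crossE u w, u⟫ = (0 : ℝ) := by rw [real_inner_comm, inner_self_crossE]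
    have e2 : ⟪crossE u w, w⟫ = (0 : ℝ) := by
      rw [crossE_neg_comm w u, inner_neg_left, real_inner_comm, inner_self_crossE, neg_zero]
    simp only [real_inner_smul_right, e1, mul_zero] at h1
    rw [rotAxisDir_eq, inner_add_right, inner_add_right, real_inner_smul_right,
      real_inner_smul_right, real_inner_smul_right, e1, e2, crossE_neg_comm u w, inner_neg_right,
      real_inner_self_eq_norm_sq, Real.sin_neg] at h1
    have : Real.sin α * ‖crossE u w‖ ^ 2 = 0 := by linarith
    simp [hs, huw] at this
  refine ⟨ha2, ?_⟩
  have hαπ : α = Real.pi := by rw [hα, ha2]; push_cast; ring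
  rw [hαπ, rotAxisDir_eq, Real.cos_neg, Real.sin_neg, Real.cos_pi, Real.sin_pi, crossE_add,
    crossE_add, crossE_smul, crossE_smul, crossE_smul, crossE_self] at h
  rw [real_inner_comm]
  norm_num at h
  exact h.resolve_right huw

end Rotation

/-- A closed embedded curve symmetric under the rotations by `2π / a` and `2π / b`, with `a ≥ 3`
and `b ≥ 2`, about two non-parallel axes through `q` has `b = 2` and perpendicular axes. -/
theorem half_turn_of_rotational_symmetries
    {Γ : ℝ → EuclideanSpace ℝ (Fin 3)} {K : NNReal} (hlip : LipschitzWith K Γ)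
    (hper : Function.Periodic Γ 1) (hinj : InjOn Γ (Ico 0 1)) {a b : ℕ} (ha : 3 ≤ a)
    (hb : 2 ≤ b) {q u w : EuclideanSpace ℝ (Fin 3)} (hu : ‖u‖ = 1) (hw : ‖w‖ = 1)
    (huw : crossE u w ≠ 0)
    (hR : rotLine (2 * Real.pi / a) q u '' range Γ = range Γ)
    (hS : rotLine (2 * Real.pi / b) q w '' range Γ = range Γ) :
    b = 2 ∧ ⟪u, w⟫ = (0 : ℝ) := by
  have hs := sin_two_pi_div_ne_zero ha
  set β := 2 * Real.pi / a
  set α := 2 * Real.pi / b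
  obtain ⟨x, hx, hxu⟩ : ∃ x ∈ range Γ, crossE u (x - q) ≠ 0 := by
    by_contra! hcon
    refine not_injOn_real_of_closedCurve hlip.continuous hper hinj
      (g := fun x => ⟪u, x - q⟫) (by fun_prop) ?_
    intro x hx y hy hxy
    have hxy' : ⟪u, x - q⟫ = ⟪u, y - q⟫ := hxy
    have h1 := eq_inner_smul_of_crossE_eq_zero hu (hcon x hx)
    rw [hxy', ← eq_inner_smul_of_crossE_eq_zero hu (hcon y hy)] at h1
    exact sub_left_injective h1
  have hRx : rotLine β q u x ∈ range Γ := hR ▸ mem_image_of_mem _ hx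
  have hR2 : rotLine β q u (rotLine β q u x) ≠ x := by
    intro h
    refine hxu (crossE_eq_zero_of_rotAxisDir_involutive hu hs ?_)
    rw [eq_sub_iff_add_eq']
    simpa [rotLine] using h
  have key : ∀ y ∈ range Γ, ⟪u, rotAxisDir α w (rotAxisDir β u (y - q))⟫ =
      ⟪u, rotAxisDir α w (y - q)⟫ := by
    rcases commute_or_inverts_of_isometryEquiv hlip hper hinj (rotLineEquiv β q hu)
      (rotLineEquiv α q hw) hR hS ⟨x, hx, hR2⟩ with h | h
    · intro y hy
      have e : rotLine α q w (rotLine β q u y) = rotLine β q u (rotLine α q w y) := h y hy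
      simp only [rotLine, add_sub_cancel_left, add_right_inj] at e
      rw [e, inner_rotAxisDir _ _ hu]
    · intro y hy
      have e : rotLine β q u (rotLine α q w (rotLine β q u y)) = rotLine α q w y := h y hy
      simp only [rotLine, add_sub_cancel_left, add_right_inj] at e
      rw [← e, inner_rotAxisDir _ _ hu]
  have hadj : ∀ z, ⟪u, rotAxisDir α w z⟫ = ⟪rotAxisDir (-α) w u, z⟫ := by
    intro z
    rw [← inner_rotAxisDir_rotAxisDir (-α) _ _ hw, rotAxisDir_neg_rotAxisDir _ _ hw]
  simp only [hadj] at key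
  refine half_turn_of_preserves_direction hb huw ?_ hu
  refine crossE_eq_zero_of_inner_orbit hu hs hxu (key x hx) ?_
  simpa [rotLine] using key _ hRx

/-- if a closed embedded curve of positive length has two axes of rotational
symmetry with distinct rotational angles `2π/a₁ ≠ 2π/a₂` (`a₁, a₂ ≥ 2`) intersecting in a
single point, then the axes are perpendicular and one of `a₁, a₂` equals `2` while the other
is at least `3`. -/
theorem distinct_angle_axes_perpendicular
    (Γ : ℝ → EuclideanSpace ℝ (Fin 3)) (K : NNReal) (hΓlip : LipschitzWith K Γ)
    (hΓper : Function.Periodic Γ 1) (hΓinj : Set.InjOn Γ (Set.Ico 0 1))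
    (hlen : 0 < ∫ τ in (0:ℝ)..1, ‖deriv Γ τ‖)
    (a₁ a₂ : ℕ) (ha₁ : 2 ≤ a₁) (ha₂ : 2 ≤ a₂) (hne : a₁ ≠ a₂)
    (p₁ u₁ p₂ u₂ : EuclideanSpace ℝ (Fin 3)) (hu₁ : ‖u₁‖ = 1) (hu₂ : ‖u₂‖ = 1)
    (hsym₁ : rotLine (2 * Real.pi / a₁) p₁ u₁ '' Set.range Γ = Set.range Γ)
    (hsym₂ : rotLine (2 * Real.pi / a₂) p₂ u₂ '' Set.range Γ = Set.range Γ)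
    (q : EuclideanSpace ℝ (Fin 3))
    (hq : affLine p₁ u₁ ∩ affLine p₂ u₂ = {q}) :
    ⟪u₁, u₂⟫ = (0:ℝ) ∧ ((a₁ = 2 ∧ 3 ≤ a₂) ∨ (a₂ = 2 ∧ 3 ≤ a₁)) := by
  have hq₁ : q ∈ affLine p₁ u₁ := (hq.ge rfl).1
  have hq₂ : q ∈ affLine p₂ u₂ := (hq.ge rfl).2
  rw [rotLine_eq_of_mem_affLine _ hu₁ hq₁] at hsym₁
  rw [rotLine_eq_of_mem_affLine _ hu₂ hq₂] at hsym₂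
  have hcross : crossE u₁ u₂ ≠ 0 := by
    intro h
    have hpar := eq_inner_smul_of_crossE_eq_zero hu₁ h
    have hmem : q + u₂ ∈ affLine p₁ u₁ ∩ affLine p₂ u₂ := by
      obtain ⟨c, hc⟩ := hq₁
      obtain ⟨d, hd⟩ := hq₂
      constructor
      · refine ⟨c + ⟪u₁, u₂⟫, ?_⟩
        rw [add_smul, ← hpar, hc, add_assoc]
      · refine ⟨d + 1, ?_⟩
        rw [hd, add_smul, one_smul, add_assoc]
    rw [hq, mem_singleton_iff, add_eq_left] at hmem
    simp [hmem] at hu₂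
  by_cases h₁ : 3 ≤ a₁
  · obtain ⟨h2, hperp⟩ := half_turn_of_rotational_symmetries hΓlip hΓper hΓinj h₁ ha₂ hu₁ hu₂
      hcross hsym₁ hsym₂
    exact ⟨hperp, Or.inr ⟨h2, h₁⟩⟩
  · have hcross' : crossE u₂ u₁ ≠ 0 := by rw [crossE_neg_comm]; exact neg_ne_zero.2 hcross
    obtain ⟨h2, hperp⟩ := half_turn_of_rotational_symmetries hΓlip hΓper hΓinj (by omega) ha₁
      hu₂ hu₁ hcross' hsym₂ hsym₁
    exact ⟨by rw [real_inner_comm]; exact hperp, Or.inl ⟨h2, by omega⟩⟩
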